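/- As q → ∞ along odd integers, both N(4,q)/q³ → 1/72 and Medim(4,q)/q³ → 1/72; i.e. for every ε > 0 there is Q such that for all odd q ≥ Q one has |N(4,q)/q³ − 1/72| < ε and |Medim(4,q)/q³ − 1/72| < ε. -/

import Mathlib

/-- A numerical semigroup: a submonoid of (ℕ,+) with finite complement. -/
def IsNumericalSemigroup (H : Set ℕ) : Prop :=
  0 ∈ H ∧ (∀ a ∈ H, ∀ b ∈ H, a + b ∈ H) ∧ Hᶜ.Finite

/-- The embedding dimension: cardinality of the minimal generating set
`(H∖{0}) ∖ ((H∖{0}) + (H∖{0}))`. -/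
noncomputable def edim (H : Set ℕ) : ℕ :=
  ((H \ {0}) \ {n | ∃ a ∈ H \ {0}, ∃ b ∈ H \ {0}, n = a + b}).ncard

/-- The multiplicity: smallest positive element. -/
noncomputable def mult (H : Set ℕ) : ℕ := sInf {n | n ∈ H ∧ 0 < n}

/-- `N p q`: the number of numerical semigroups containing both `p` and `q`. -/
noncomputable def countNS (p q : ℕ) : ℕ :=
  {H : Set ℕ | IsNumericalSemigroup H ∧ p ∈ H ∧ q ∈ H}.ncard

/-- `Medim p q`: the number of numerical semigroups of maximal embedding
dimension `p` (i.e. `m(H) = edim(H) = p`) containing `q`. -/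
noncomputable def countMaxEdim (p q : ℕ) : ℕ :=
  {H : Set ℕ | IsNumericalSemigroup H ∧ mult H = p ∧ edim H = p ∧ q ∈ H}.ncard

/-- The set of naturals `n` that are at least `4 * a + 1`, `4 * b + 2`, `4 * c + 3` when
`n ≡ 1, 2, 3 [MOD 4]` respectively: the candidate semigroup with Kunz coordinates `(a, b, c)`. -/
def kunzSet (k : ℕ × ℕ × ℕ) : Set ℕ :=
  {n | (n % 4 = 1 → 4 * k.1 + 1 ≤ n) ∧ (n % 4 = 2 → 4 * k.2.1 + 2 ≤ n) ∧
    (n % 4 = 3 → 4 * k.2.2 + 3 ≤ n)}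

theorem mem_kunzSet {a b c n : ℕ} : n ∈ kunzSet (a, b, c) ↔
    (n % 4 = 1 → 4 * a + 1 ≤ n) ∧ (n % 4 = 2 → 4 * b + 2 ≤ n) ∧ (n % 4 = 3 → 4 * c + 3 ≤ n) :=
  Iff.rfl

theorem kunzSet_injective : Function.Injective kunzSet := by
  rintro ⟨a, b, c⟩ ⟨a', b', c'⟩ h
  have key (n : ℕ) : n ∈ kunzSet (a, b, c) ↔ n ∈ kunzSet (a', b', c') := by rw [h]
  simp only [mem_kunzSet] at key
  have h1 := key (4 * a + 1)
  have h2 := key (4 * b + 2)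
  have h3 := key (4 * c + 3)
  have h1' := key (4 * a' + 1)
  have h2' := key (4 * b' + 2)
  have h3' := key (4 * c' + 3)
  simp only [Prod.mk.injEq]
  refine ⟨?_, ?_, ?_⟩
  · clear h2 h3 h2' h3'; omega
  · clear h1 h3 h1' h3'; omega
  · clear h1 h2 h1' h2'; omega

theorem isNumericalSemigroup_kunzSet {a b c : ℕ} (h₁ : b ≤ 2 * a) (h₂ : b ≤ 2 * c + 1)
    (h₃ : c ≤ a + b) (h₄ : a ≤ b + c + 1) : IsNumericalSemigroup (kunzSet (a, b, c)) := by
  refine ⟨by simp [mem_kunzSet], fun m hm n hn => ?_, ?_⟩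
  · rw [mem_kunzSet] at *
    obtain ⟨m1, m2, m3⟩ := hm
    obtain ⟨n1, n2, n3⟩ := hn
    have hm4 : m % 4 < 4 := Nat.mod_lt _ (by norm_num)
    have hn4 : n % 4 < 4 := Nat.mod_lt _ (by norm_num)
    refine ⟨fun h => ?_, fun h => ?_, fun h => ?_⟩ <;>
      interval_cases hm' : m % 4 <;> interval_cases hn' : n % 4 <;>
      simp at m1 m2 m3 n1 n2 n3 <;> omega
  · refine (Set.finite_lt_nat (4 * a + 4 * b + 4 * c + 4)).subset fun n hn => ?_
    rw [Set.mem_compl_iff, mem_kunzSet] at hn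
    rw [Set.mem_ofPred_eq]
    by_contra hlt
    exact hn ⟨fun _ => by omega, fun _ => by omega, fun _ => by omega⟩

/-- A numerical semigroup has a least element in each residue class modulo any of its elements;
here for the modulus `4`. -/
theorem IsNumericalSemigroup.exists_forall_mem_iff {H : Set ℕ} (hH : IsNumericalSemigroup H)
    (h4 : 4 ∈ H) (r : ℕ) : ∃ k, ∀ j, 4 * j + r ∈ H ↔ k ≤ j := by
  classical
  obtain ⟨-, hadd, hfin⟩ := hH
  have hex : ∃ k, 4 * k + r ∈ H := by
    obtain ⟨B, hB⟩ := hfin.bddAbove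
    refine ⟨B + 1, by_contra fun h => ?_⟩
    have := hB h
    omega
  refine ⟨Nat.find hex, fun j => ⟨fun h => Nat.find_min' hex h, fun h => ?_⟩⟩
  induction j, h using Nat.le_induction with
  | base => exact Nat.find_spec hex
  | succ j _ ih =>
    have := hadd _ ih _ h4
    rwa [show 4 * j + r + 4 = 4 * (j + 1) + r by ring] at this

theorem IsNumericalSemigroup.exists_eq_kunzSet {H : Set ℕ} (hH : IsNumericalSemigroup H)
    (h4 : 4 ∈ H) : ∃ a b c, H = kunzSet (a, b, c) ∧ b ≤ 2 * a ∧ b ≤ 2 * c + 1 ∧ c ≤ a + b ∧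
      a ≤ b + c + 1 := by
  obtain ⟨z, hz⟩ := hH.exists_forall_mem_iff h4 0
  obtain ⟨a, ha⟩ := hH.exists_forall_mem_iff h4 1
  obtain ⟨b, hb⟩ := hH.exists_forall_mem_iff h4 2
  obtain ⟨c, hc⟩ := hH.exists_forall_mem_iff h4 3
  have hz0 : z ≤ 0 := (hz 0).1 hH.1
  have ha' := (ha a).2 le_rfl
  have hb' := (hb b).2 le_rfl
  have hc' := (hc c).2 le_rfl
  refine ⟨a, b, c, ?_, ?_, ?_, ?_, ?_⟩
  · ext n
    rw [mem_kunzSet]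
    have hn := Nat.div_add_mod n 4
    have hcases : n % 4 = 0 ∨ n % 4 = 1 ∨ n % 4 = 2 ∨ n % 4 = 3 := by omega
    rcases hcases with h | h | h | h <;> rw [h] at hn
    · have := hz (n / 4)
      rw [hn] at this
      rw [this]
      omega
    · have := ha (n / 4)
      rw [hn] at this
      rw [this]
      omega
    · have := hb (n / 4)
      rw [hn] at this
      rw [this]
      omega
    · have := hc (n / 4)
      rw [hn] at this
      rw [this]
      omega
  · refine (hb _).1 ?_
    convert hH.2.1 _ ha' _ ha' using 1
    ring
  · refine (hb _).1 ?_
    convert hH.2.1 _ hc' _ hc' using 1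
    ring
  · refine (hc _).1 ?_
    convert hH.2.1 _ ha' _ hb' using 1
    ring
  · refine (ha _).1 ?_
    convert hH.2.1 _ hb' _ hc' using 1
    ring

theorem mult_kunzSet {a b c : ℕ} (ha : 1 ≤ a) (hb : 1 ≤ b) (hc : 1 ≤ c) :
    mult (kunzSet (a, b, c)) = 4 := by
  refine le_antisymm (Nat.sInf_le ⟨by simp [mem_kunzSet], by norm_num⟩)
    (le_csInf ⟨4, by simp [mem_kunzSet], by norm_num⟩ ?_)
  rintro n ⟨hn, hn0⟩
  rw [mem_kunzSet] at hn
  omega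

theorem edim_kunzSet {a b c : ℕ} (ha : 1 ≤ a) (hb : 1 ≤ b) (hc : 1 ≤ c)
    (h₁ : b < 2 * a) (h₂ : b < 2 * c + 1) (h₃ : c < a + b) (h₄ : a < b + c + 1) :
    edim (kunzSet (a, b, c)) = 4 := by
  have hgen : (kunzSet (a, b, c) \ {0}) \
      {n | ∃ x ∈ kunzSet (a, b, c) \ {0}, ∃ y ∈ kunzSet (a, b, c) \ {0}, n = x + y} =
      (({4, 4 * a + 1, 4 * b + 2, 4 * c + 3} : Finset ℕ) : Set ℕ) := by
    ext n
    simp only [Set.mem_sdiff, Set.mem_singleton_iff, Set.mem_ofPred_eq, mem_kunzSet,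
      Finset.coe_insert, Finset.coe_singleton, Set.mem_insert_iff]
    constructor
    · rintro ⟨⟨hn, hn0⟩, hdec⟩
      by_contra hne
      refine hdec ⟨4, by simp, n - 4, ⟨?_, by omega⟩, by omega⟩
      refine ⟨fun h => ?_, fun h => ?_, fun h => ?_⟩ <;> omega
    · intro hn
      refine ⟨⟨by omega, by omega⟩, ?_⟩
      rintro ⟨x, ⟨⟨x1, x2, x3⟩, hx0⟩, y, ⟨⟨y1, y2, y3⟩, hy0⟩, hxy⟩
      have hx4 : x % 4 < 4 := Nat.mod_lt _ (by norm_num)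
      have hy4 : y % 4 < 4 := Nat.mod_lt _ (by norm_num)
      interval_cases hx' : x % 4 <;> interval_cases hy' : y % 4 <;>
        simp at x1 x2 x3 y1 y2 y3 <;> omega
  rw [edim, hgen, Set.ncard_coe_finset]
  rw [Finset.card_insert_of_notMem, Finset.card_insert_of_notMem, Finset.card_insert_of_notMem,
    Finset.card_singleton] <;> simp <;> omega

/-- An antiderivative in `y` of `min (2 * y) (u + y / 2)`. -/
noncomputable def sliceArea (u y : ℝ) : ℝ :=
  u * y + y ^ 2 / 4 - u ^ 2 / 3 + max 0 (u - 3 * y / 2) ^ 2 / 3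

theorem abs_sliceArea_step (u y : ℝ) :
    |min (2 * y) (u + y / 2) - (sliceArea u (y + 1) - sliceArea u y)| ≤ 2 := by
  unfold sliceArea
  rw [abs_le]
  rcases le_total (u - 3 * y / 2) 0 with h | h
  · rw [max_eq_left h, max_eq_left (by linarith), min_eq_right (by linarith)]
    constructor <;> nlinarith
  · rw [max_eq_right h, min_eq_left (by linarith)]
    rcases le_total (u - 3 * (y + 1) / 2) 0 with h' | h'
    · rw [max_eq_left h']
      constructor <;> nlinarith
    · rw [max_eq_right h']
      constructor <;> nlinarith

theorem abs_sum_min_sub_sliceArea {u : ℝ} (hu : 0 ≤ u) (n : ℕ) :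
    |∑ y ∈ Finset.range n, min (2 * (y : ℝ)) (u + y / 2) - sliceArea u n| ≤ 2 * n := by
  induction n with
  | zero => simp [sliceArea, hu]
  | succ n ih =>
    rw [Finset.sum_range_succ]
    have := abs_sliceArea_step u n
    push_cast
    rw [abs_le] at *
    constructor <;> linarith [this.1, this.2, ih.1, ih.2]

/-- Triples satisfying the Kunz inequalities for multiplicity `4` up to an additive slack of one. -/
def looseTriples (t : ℕ) : Finset (ℕ × ℕ × ℕ) :=
  (Finset.range (t + 1)).biUnion fun u => (Finset.range (2 * u + 2)).biUnion fun y =>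
    (Finset.Icc (max (y / 2) (u - 1 - y)) (u + y + 1)).image fun v => (u, y, v)

/-- Triples satisfying the Kunz inequalities for multiplicity `4` with a margin of one. -/
def strictTriples (t : ℕ) : Finset (ℕ × ℕ × ℕ) :=
  (Finset.range (t + 1)).biUnion fun u => (Finset.range (2 * u)).biUnion fun y =>
    (Finset.Icc (max ((y + 2) / 2) (u + 1 - y)) (u + y - 1)).image fun v => (u, y, v)

theorem mem_looseTriples {t u y v : ℕ} (hu : u ≤ t) (h₁ : y ≤ 2 * u + 1) (h₂ : y ≤ 2 * v + 1)
    (h₃ : v ≤ u + y + 1) (h₄ : u ≤ y + v + 1) : (u, y, v) ∈ looseTriples t := by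
  simp only [looseTriples, Finset.mem_biUnion, Finset.mem_range, Finset.mem_image, Finset.mem_Icc]
  exact ⟨u, by omega, y, by omega, v, ⟨by omega, by omega⟩, rfl⟩

theorem of_mem_strictTriples {t u y v : ℕ} (h : (u, y, v) ∈ strictTriples t) :
    u ≤ t ∧ 1 ≤ u ∧ 1 ≤ y ∧ 1 ≤ v ∧ y < 2 * u ∧ y < 2 * v ∧ v < u + y ∧ u < y + v := by
  simp only [strictTriples, Finset.mem_biUnion, Finset.mem_range, Finset.mem_image,
    Finset.mem_Icc, Prod.mk.injEq] at h
  obtain ⟨u, hu, y, hy, v, ⟨h1, h2⟩, rfl, rfl, rfl⟩ := h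
  omega

theorem card_looseTriples_le (t : ℕ) :
    ((looseTriples t).card : ℝ) ≤ 8 / 9 * t ^ 3 + 100 * (t + 1) ^ 2 := by
  have hslice (u y : ℕ) : (((Finset.Icc (max (y / 2) (u - 1 - y)) (u + y + 1)).image
      fun v => (u, y, v)).card : ℝ) ≤ min (2 * (y : ℝ)) (u + y / 2) + 4 := by
    refine le_trans (Nat.cast_le.2 Finset.card_image_le) ?_
    rw [Nat.card_Icc, ← min_add_add_right, le_min_iff]
    constructor
    · exact_mod_cast (show _ ≤ 2 * y + 4 by omega)
    · have : 2 * (u + y + 1 + 1 - max (y / 2) (u - 1 - y)) ≤ 2 * u + y + 8 := by omega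
      have : (2 : ℝ) * ((u + y + 1 + 1 - max (y / 2) (u - 1 - y) : ℕ) : ℝ) ≤ 2 * u + y + 8 := by
        exact_mod_cast this
      linarith
  have hrow (u : ℕ) : (((Finset.range (2 * u + 2)).biUnion fun y =>
      (Finset.Icc (max (y / 2) (u - 1 - y)) (u + y + 1)).image fun v => (u, y, v)).card : ℝ) ≤
      8 / 3 * u ^ 2 + 20 * (u + 1) := by
    refine le_trans (Nat.cast_le.2 Finset.card_biUnion_le) ?_
    push_cast
    refine le_trans (Finset.sum_le_sum fun y _ => hslice u y) ?_
    have := (abs_le.1 (abs_sum_min_sub_sliceArea (u.cast_nonneg (α := ℝ)) (2 * u + 2))).2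
    rw [Finset.sum_add_distrib, Finset.sum_const, Finset.card_range, nsmul_eq_mul]
    have hu := u.cast_nonneg (α := ℝ)
    rw [sliceArea, max_eq_left (by push_cast; linarith)] at this
    push_cast at this ⊢
    nlinarith
  refine le_trans (Nat.cast_le.2 Finset.card_biUnion_le) ?_
  push_cast
  refine le_trans (Finset.sum_le_sum fun u _ => hrow u) ?_
  induction t with
  | zero => norm_num
  | succ t ih =>
    rw [Finset.sum_range_succ]
    push_cast
    nlinarith [t.cast_nonneg (α := ℝ)]

theorem le_card_strictTriples (t : ℕ) :
    8 / 9 * (t : ℝ) ^ 3 - 100 * (t + 1) ^ 2 ≤ ((strictTriples t).card : ℝ) := by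
  have hslice (u y : ℕ) (hy : y < 2 * u) : min (2 * (y : ℝ)) (u + y / 2) - 4 ≤
      (((Finset.Icc (max ((y + 2) / 2) (u + 1 - y)) (u + y - 1)).image
      fun v => (u, y, v)).card : ℝ) := by
    rw [Finset.card_image_of_injective _ (fun v w h => by simpa using h), Nat.card_Icc]
    rcases le_total (y + 2) (2 * (u + 1 - y)) with h | h
    · have : 2 * y ≤ u + y - 1 + 1 - max ((y + 2) / 2) (u + 1 - y) + 4 := by omega
      have : (2 : ℝ) * y ≤ ((u + y - 1 + 1 - max ((y + 2) / 2) (u + 1 - y) : ℕ) : ℝ) + 4 := by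
        exact_mod_cast this
      linarith [min_le_left (2 * (y : ℝ)) (u + y / 2)]
    · have : 2 * u + y ≤ 2 * (u + y - 1 + 1 - max ((y + 2) / 2) (u + 1 - y)) + 8 := by omega
      have : (2 : ℝ) * u + y ≤
          2 * ((u + y - 1 + 1 - max ((y + 2) / 2) (u + 1 - y) : ℕ) : ℝ) + 8 := by
        exact_mod_cast this
      linarith [min_le_right (2 * (y : ℝ)) (u + y / 2)]
  have hrow (u : ℕ) : 8 / 3 * (u : ℝ) ^ 2 - 20 * (u + 1) ≤
      (((Finset.range (2 * u)).biUnion fun y =>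
      (Finset.Icc (max ((y + 2) / 2) (u + 1 - y)) (u + y - 1)).image
        fun v => (u, y, v)).card : ℝ) := by
    rw [Finset.card_biUnion]
    · push_cast
      refine le_trans ?_ (Finset.sum_le_sum fun y hy => hslice u y (Finset.mem_range.1 hy))
      have := (abs_le.1 (abs_sum_min_sub_sliceArea (u.cast_nonneg (α := ℝ)) (2 * u))).1
      rw [Finset.sum_sub_distrib, Finset.sum_const, Finset.card_range, nsmul_eq_mul]
      have hu := u.cast_nonneg (α := ℝ)
      rw [sliceArea, max_eq_left (by push_cast; linarith)] at this
      push_cast at this ⊢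
      nlinarith
    · intro y _ y' _ hne
      rw [Function.onFun, Finset.disjoint_left]
      simp only [Finset.mem_image, not_exists, not_and]
      rintro _ ⟨v, -, rfl⟩ w - h
      exact hne (by simp only [Prod.mk.injEq] at h; exact h.2.1.symm)
  rw [strictTriples, Finset.card_biUnion]
  · push_cast
    refine le_trans ?_ (Finset.sum_le_sum fun u _ => hrow u)
    induction t with
    | zero => norm_num
    | succ t ih =>
      rw [Finset.sum_range_succ]
      push_cast
      nlinarith [t.cast_nonneg (α := ℝ)]
  · intro u _ u' _ hne
    rw [Function.onFun, Finset.disjoint_left]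
    simp only [Finset.mem_biUnion, Finset.mem_image, not_exists, not_and]
    rintro _ ⟨y, -, v, -, rfl⟩ y' - w - h
    exact hne (by simp only [Prod.mk.injEq] at h; exact h.1.symm)

/-- Swapping the outer Kunz coordinates exchanges the residues `1` and `3` modulo `4`; the first
coordinate of the triple becomes the one bounded by `q`. -/
def orientedKunzSet (q : ℕ) (k : ℕ × ℕ × ℕ) : Set ℕ :=
  if q % 4 = 1 then kunzSet k else kunzSet (k.2.2, k.2.1, k.1)

theorem orientedKunzSet_injective (q : ℕ) : Function.Injective (orientedKunzSet q) := by
  rintro ⟨a, b, c⟩ ⟨a', b', c'⟩ h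
  unfold orientedKunzSet at h
  split_ifs at h
  · exact kunzSet_injective h
  · have := kunzSet_injective h
    simp only [Prod.mk.injEq] at this ⊢
    tauto

theorem setOf_semigroup_subset_image {q : ℕ} (hq : Odd q) :
    {H : Set ℕ | IsNumericalSemigroup H ∧ 4 ∈ H ∧ q ∈ H} ⊆
      orientedKunzSet q '' (looseTriples (q / 4)) := by
  rintro H ⟨hH, h4, hqH⟩
  obtain ⟨a, b, c, rfl, h₁, h₂, h₃, h₄⟩ := hH.exists_eq_kunzSet h4
  rw [mem_kunzSet] at hqH
  rw [Nat.odd_iff] at hq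
  by_cases hq1 : q % 4 = 1
  · exact ⟨(a, b, c), mem_looseTriples (by omega) (by omega) (by omega) (by omega) (by omega),
      by simp [orientedKunzSet, hq1]⟩
  · exact ⟨(c, b, a), mem_looseTriples (by omega) (by omega) (by omega) (by omega) (by omega),
      by simp [orientedKunzSet, hq1]⟩

theorem image_subset_setOf_maxEdim {q : ℕ} (hq : Odd q) :
    orientedKunzSet q '' (strictTriples (q / 4)) ⊆
      {H : Set ℕ | IsNumericalSemigroup H ∧ mult H = 4 ∧ edim H = 4 ∧ q ∈ H} := by
  rintro _ ⟨⟨u, y, v⟩, hk, rfl⟩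
  obtain ⟨hu, hu1, hy1, hv1, h₁, h₂, h₃, h₄⟩ := of_mem_strictTriples hk
  rw [Nat.odd_iff] at hq
  unfold orientedKunzSet
  split_ifs with hq1
  · refine ⟨isNumericalSemigroup_kunzSet ?_ ?_ ?_ ?_, mult_kunzSet ?_ ?_ ?_,
      edim_kunzSet ?_ ?_ ?_ ?_ ?_ ?_ ?_, mem_kunzSet.2 ?_⟩ <;> omega
  · refine ⟨isNumericalSemigroup_kunzSet ?_ ?_ ?_ ?_, mult_kunzSet ?_ ?_ ?_,
      edim_kunzSet ?_ ?_ ?_ ?_ ?_ ?_ ?_, mem_kunzSet.2 ?_⟩ <;> dsimp only <;> omega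

theorem setOf_maxEdim_subset_setOf_semigroup (q : ℕ) :
    {H : Set ℕ | IsNumericalSemigroup H ∧ mult H = 4 ∧ edim H = 4 ∧ q ∈ H} ⊆
      {H : Set ℕ | IsNumericalSemigroup H ∧ 4 ∈ H ∧ q ∈ H} := by
  rintro H ⟨hH, hm, -, hq⟩
  refine ⟨hH, ?_, hq⟩
  have hne : {n | n ∈ H ∧ 0 < n}.Nonempty := Nat.nonempty_of_sInf_eq_succ hm
  have := Nat.sInf_mem hne
  rw [mult] at hm
  rw [hm] at this
  exact this.1

theorem countNS_le_card_looseTriples {q : ℕ} (hq : Odd q) :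
    countNS 4 q ≤ (looseTriples (q / 4)).card := by
  rw [← Set.ncard_coe_finset, ← Set.ncard_image_of_injective _ (orientedKunzSet_injective q)]
  exact Set.ncard_le_ncard (setOf_semigroup_subset_image hq)
    ((Finset.finite_toSet _).image _)

theorem countMaxEdim_le_countNS {q : ℕ} (hq : Odd q) : countMaxEdim 4 q ≤ countNS 4 q :=
  Set.ncard_le_ncard (setOf_maxEdim_subset_setOf_semigroup q)
    (((Finset.finite_toSet _).image _).subset (setOf_semigroup_subset_image hq))

theorem card_strictTriples_le_countMaxEdim {q : ℕ} (hq : Odd q) :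
    (strictTriples (q / 4)).card ≤ countMaxEdim 4 q := by
  rw [← Set.ncard_coe_finset, ← Set.ncard_image_of_injective _ (orientedKunzSet_injective q)]
  exact Set.ncard_le_ncard (image_subset_setOf_maxEdim hq)
    (((Finset.finite_toSet _).image _).subset
      ((setOf_maxEdim_subset_setOf_semigroup q).trans (setOf_semigroup_subset_image hq)))

theorem countNS_four_le {q : ℕ} (hq : Odd q) :
    (countNS 4 q : ℝ) ≤ q ^ 3 / 72 + 200 * (q + 1) ^ 2 := by
  have h₁ : (countNS 4 q : ℝ) ≤ (looseTriples (q / 4)).card := by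
    exact_mod_cast countNS_le_card_looseTriples hq
  have h₂ := card_looseTriples_le (q / 4)
  have h₃ : (4 : ℝ) * (q / 4 : ℕ) ≤ q := by exact_mod_cast Nat.mul_div_le q 4
  have ht := (q / 4).cast_nonneg (α := ℝ)
  generalize ((q / 4 : ℕ) : ℝ) = t at *
  have hcube : (4 * t) ^ 3 ≤ (q : ℝ) ^ 3 := pow_le_pow_left₀ (by positivity) h₃ 3
  have hsq : (t + 1) ^ 2 ≤ ((q : ℝ) + 1) ^ 2 := pow_le_pow_left₀ (by positivity) (by linarith) 2
  nlinarith

theorem le_countMaxEdim_four {q : ℕ} (hq : Odd q) :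
    (q : ℝ) ^ 3 / 72 - 200 * (q + 1) ^ 2 ≤ countMaxEdim 4 q := by
  have h₁ : ((strictTriples (q / 4)).card : ℝ) ≤ countMaxEdim 4 q := by
    exact_mod_cast card_strictTriples_le_countMaxEdim hq
  have h₂ := le_card_strictTriples (q / 4)
  have h₃ : (q : ℝ) ≤ 4 * (q / 4 : ℕ) + 3 := by
    exact_mod_cast (show q ≤ 4 * (q / 4) + 3 by omega)
  have h₄ : (4 : ℝ) * (q / 4 : ℕ) ≤ q := by exact_mod_cast Nat.mul_div_le q 4
  have ht := (q / 4).cast_nonneg (α := ℝ)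
  generalize ((q / 4 : ℕ) : ℝ) = t at *
  have hcube : (q : ℝ) ^ 3 ≤ (4 * t + 3) ^ 3 := pow_le_pow_left₀ (by positivity) h₃ 3
  have hsq : (t + 1) ^ 2 ≤ ((q : ℝ) + 1) ^ 2 := pow_le_pow_left₀ (by positivity) (by linarith) 2
  nlinarith

theorem abs_div_cube_sub_lt {x q ε : ℝ} (hq : 1 ≤ q) (hε : 800 / ε < q) (hε0 : 0 < ε)
    (hx : |x - q ^ 3 / 72| ≤ 200 * (q + 1) ^ 2) : |x / q ^ 3 - 1 / 72| < ε := by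
  have hq3 : 0 < q ^ 3 := by positivity
  rw [show x / q ^ 3 - 1 / 72 = (x - q ^ 3 / 72) / q ^ 3 by field_simp, abs_div, abs_of_pos hq3,
    div_lt_iff₀ hq3]
  rw [div_lt_iff₀ hε0] at hε
  have h1 : 200 * (q + 1) ^ 2 ≤ 800 * q ^ 2 := by nlinarith
  have h2 : 800 * q ^ 2 < q * ε * q ^ 2 := mul_lt_mul_of_pos_right hε (by positivity)
  calc _ ≤ _ := hx
    _ < q * ε * q ^ 2 := h1.trans_lt h2
    _ = ε * q ^ 3 := by ring

/-- `N(4,q)/q³ → 1/72` and `Medim(4,q)/q³ → 1/72` as `q → ∞` along odd integers. -/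
theorem countNS_countMaxEdim_four_limit :
    ∀ ε : ℝ, 0 < ε → ∃ Q : ℕ, ∀ q : ℕ, Q ≤ q → Odd q →
      |(countNS 4 q : ℝ) / (q : ℝ) ^ 3 - 1 / 72| < ε ∧
      |(countMaxEdim 4 q : ℝ) / (q : ℝ) ^ 3 - 1 / 72| < ε := by

  intro ε hε
  obtain ⟨Q, hQ⟩ := exists_nat_gt (800 / ε)
  refine ⟨Q, fun q hqQ hodd => ?_⟩
  have hq : (1 : ℝ) ≤ q := by exact_mod_cast hodd.pos
  have hlarge : 800 / ε < q := hQ.trans_le (by exact_mod_cast hqQ)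
  have hupper := countNS_four_le hodd
  have hlower := le_countMaxEdim_four hodd
  have hmid : (countMaxEdim 4 q : ℝ) ≤ countNS 4 q := by
    exact_mod_cast countMaxEdim_le_countNS hodd
  constructor <;> refine abs_div_cube_sub_lt hq hlarge hε ?_ <;> rw [abs_le] <;>
    constructor <;> linarith
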